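/- Let f : ℝ² → ℍ with ∫_{ℝ²} |f(s,t)| ds dt < ∞, and suppose its right-sided quaternion linear canonical transform 𝓛_R(f) satisfies ∫_{ℝ²} |𝓛_R(f)(u,v)| du dv < ∞. Then f(s,t) = ∫_{ℝ²} 𝓛_R(f)(u,v) K_{A₂⁻¹}^j(v,t) K_{A₁⁻¹}^i(u,s) du dv for almost every (s,t) ∈ ℝ². -/

import Mathlib

open MeasureTheory Filter Real Set
open scoped Quaternion Topology

noncomputable section

def qi : ℍ[ℝ] := ⟨0,1,0,0⟩
def qj : ℍ[ℝ] := ⟨0,0,1,0⟩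

/-- `e^{μθ} = cos θ + μ sin θ` for a (pure unit) quaternion `μ`. -/
def qexp (μ : ℍ[ℝ]) (θ : ℝ) : ℍ[ℝ] := (Real.cos θ : ℍ[ℝ]) + Real.sin θ • μ

/-- QLCT kernel `K_{A₁}^i(s,u) = (2πb)^{-1/2} e^{-iπ/4} e^{i(a s²/(2b) − su/b + d u²/(2b))}`. -/
def KAi (a b d s u : ℝ) : ℍ[ℝ] :=
  (Real.sqrt (2 * π * b))⁻¹ •
    (qexp qi (-(π / 4)) * qexp qi (a * s ^ 2 / (2 * b) - s * u / b + d * u ^ 2 / (2 * b)))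

/-- QLCT kernel `K_{A₂}^j(t,v) = (2πb)^{-1/2} e^{-jπ/4} e^{j(a t²/(2b) − tv/b + d v²/(2b))}`. -/
def KAj (a b d t v : ℝ) : ℍ[ℝ] :=
  (Real.sqrt (2 * π * b))⁻¹ •
    (qexp qj (-(π / 4)) * qexp qj (a * t ^ 2 / (2 * b) - t * v / b + d * v ^ 2 / (2 * b)))

/-- Inverse QLCT kernel `K_{A₁⁻¹}^i(u,s) = (2πb)^{-1/2} e^{iπ/4} e^{i(−d u²/(2b) + us/b − a s²/(2b))}`. -/
def KAiInv (a b d u s : ℝ) : ℍ[ℝ] :=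
  (Real.sqrt (2 * π * b))⁻¹ •
    (qexp qi (π / 4) * qexp qi (-(d * u ^ 2 / (2 * b)) + u * s / b - a * s ^ 2 / (2 * b)))

/-- Inverse QLCT kernel `K_{A₂⁻¹}^j(v,t) = (2πb)^{-1/2} e^{jπ/4} e^{j(−d v²/(2b) + vt/b − a t²/(2b))}`. -/
def KAjInv (a b d v t : ℝ) : ℍ[ℝ] :=
  (Real.sqrt (2 * π * b))⁻¹ •
    (qexp qj (π / 4) * qexp qj (-(d * v ^ 2 / (2 * b)) + v * t / b - a * t ^ 2 / (2 * b)))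

/-- Right-sided quaternion linear canonical transform. -/
def QLCT_R (a₁ b₁ d₁ a₂ b₂ d₂ : ℝ) (f : ℝ × ℝ → ℍ[ℝ]) (u v : ℝ) : ℍ[ℝ] :=
  ∫ p : ℝ × ℝ, f p * KAi a₁ b₁ d₁ p.1 u * KAj a₂ b₂ d₂ p.2 v


section FourierAE
open FourierTransform

lemma fourier_inv_ae (f : ℝ → ℂ) (hf : Integrable f) (hF : Integrable (𝓕 f)) :
    ∀ᵐ x, 𝓕⁻ (𝓕 f) x = f x := by
  have hcont : Continuous (𝓕⁻ (𝓕 f)) := by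
    have h : Continuous (𝓕 (𝓕 f)) :=
      VectorFourier.fourierIntegral_continuous Real.continuous_fourierChar
        (by exact continuous_inner) hF
    have : 𝓕⁻ (𝓕 f) = fun x => 𝓕 (𝓕 f) (-x) := by
      ext x; exact Real.fourierInv_eq_fourier_neg _ _
    rw [this]; exact h.comp continuous_neg
  refine ae_eq_of_integral_contDiff_smul_eq hcont.locallyIntegrable hf.locallyIntegrable ?_
  intro g hg hgs
  have hgc : HasCompactSupport (fun x => (g x : ℂ)) := hgs.comp_left (g := fun x : ℝ => (x : ℂ)) (by simp)
  have hgd : ContDiff ℝ (⊤ : ℕ∞) (fun x => (g x : ℂ)) := Complex.ofRealCLM.contDiff.comp hg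
  let φ : SchwartzMap ℝ ℂ := hgc.toSchwartzMap hgd
  have hφ : ∀ x, φ x = (g x : ℂ) := fun x => rfl
  let ψ : SchwartzMap ℝ ℂ := 𝓕⁻ φ
  have hψφ : 𝓕 (ψ : ℝ → ℂ) = φ := by
    rw [← SchwartzMap.fourier_coe]; simp [ψ]
  have hψ : (ψ : ℝ → ℂ) = 𝓕⁻ (φ : ℝ → ℂ) := SchwartzMap.fourierInv_coe φ
  have e1 : ∫ x, g x • f x = ∫ x, ψ x • 𝓕 f x := by
    have := VectorFourier.integral_fourierIntegral_smul_eq_flip (L := innerₗ ℝ) (μ := volume) (ν := volume)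
      Real.continuous_fourierChar (by exact continuous_inner) ψ.integrable hf
    rw [flip_innerₗ] at this
    change ∫ x, (𝓕 (ψ : ℝ → ℂ)) x • f x = ∫ x, ψ x • 𝓕 f x at this
    rw [hψφ] at this
    rw [← this]
    simp [hφ]
  have e2 : ∫ x, g x • 𝓕⁻ (𝓕 f) x = ∫ x, ψ x • 𝓕 f x := by
    have := VectorFourier.integral_fourierIntegral_smul_eq_flip (L := -innerₗ ℝ) (μ := volume) (ν := volume)
      Real.continuous_fourierChar (by exact continuous_inner.neg) φ.integrable hF
    have hfl : (-innerₗ ℝ).flip = -innerₗ ℝ := by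
      ext; simp
    rw [hfl] at this
    change ∫ x, (𝓕⁻ (φ : ℝ → ℂ)) x • 𝓕 f x = ∫ x, φ x • 𝓕⁻ (𝓕 f) x at this
    rw [← hψ] at this
    rw [this]
    simp [hφ]
  rw [e1, e2]

end FourierAE

/-- complex exponential of a real phase -/
def ce (θ : ℝ) : ℂ := Complex.exp (θ * Complex.I)

lemma ce_add (x y : ℝ) : ce (x + y) = ce x * ce y := by
  simp [ce, add_mul, Complex.exp_add]

lemma ce_zero : ce 0 = 1 := by simp [ce]

lemma ce_cont : Continuous ce := by unfold ce; fun_prop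

lemma ce_norm (x : ℝ) : ‖ce x‖ = 1 := Complex.norm_exp_ofReal_mul_I x

lemma scalar_inv (a b d : ℝ) (hb : 0 < b) (f : ℝ → ℂ) (hf : Integrable f)
    (hF : Integrable (fun u => ∫ s, (√(2 * π * b))⁻¹ •
      (ce (-(π / 4)) * ce (a * s ^ 2 / (2 * b) - s * u / b + d * u ^ 2 / (2 * b)) * f s))) :
    ∀ᵐ s, f s = ∫ u, (√(2 * π * b))⁻¹ •
      (ce (π / 4) * ce (-(d * u ^ 2 / (2 * b)) + u * s / b - a * s ^ 2 / (2 * b)) *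
      ∫ s, (√(2 * π * b))⁻¹ •
      (ce (-(π / 4)) * ce (a * s ^ 2 / (2 * b) - s * u / b + d * u ^ 2 / (2 * b)) * f s)) := by
  have hB : 0 < 2 * π * b := by positivity
  set B := 2 * π * b with hBdef
  set c := (√B)⁻¹ with hc
  have hcc : c * c = B⁻¹ := by
    rw [hc, ← mul_inv, Real.mul_self_sqrt hB.le]
  have hc0 : c ≠ 0 := by rw [hc]; positivity
  let g : ℝ → ℂ := fun s => ce (a * s ^ 2 / (2 * b)) * f s
  have hg : Integrable g := by
    refine hf.bdd_mul (c := 1) ?_ ?_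
    · exact (ce_cont.comp (by fun_prop)).aestronglyMeasurable
    · exact Eventually.of_forall fun s => (ce_norm _).le
  have key : ∀ u, (∫ s, c • (ce (-(π / 4)) * ce (a * s ^ 2 / (2 * b) - s * u / b + d * u ^ 2 / (2 * b)) * f s))
      = (c * (ce (-(π / 4)) * ce (d * u ^ 2 / (2 * b)))) * FourierTransform.fourier g (u / B) := by
    intro u
    rw [Real.fourier_real_eq_integral_exp_smul, ← integral_const_mul]
    congr 1; ext s
    have : Complex.exp (↑(-2 * π * s * (u / B)) * Complex.I) = ce (- (s * u / b)) := by
      unfold ce; congr 3; rw [hBdef]; field_simp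
    rw [this, show a * s ^ 2 / (2 * b) - s * u / b + d * u ^ 2 / (2 * b)
      = a * s ^ 2 / (2 * b) + -(s * u / b) + d * u ^ 2 / (2 * b) by ring, ce_add, ce_add]
    simp only [g, Complex.real_smul, smul_eq_mul]; ring
  simp_rw [key] at hF ⊢
  have hG : Integrable (FourierTransform.fourier g) := by
    have h1 : Integrable (fun u => FourierTransform.fourier g (u / B)) := by
      have := hF.bdd_mul (c := |c⁻¹|) (f := fun u => ((c⁻¹ : ℝ) : ℂ) * (ce (π / 4) * ce (-(d * u ^ 2 / (2 * b))))) ?_ ?_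
      · refine this.congr (Eventually.of_forall fun u => ?_)
        simp only
        have h2 : ce (π / 4) * ce (-(π/4)) = 1 := by rw [← ce_add]; simp [ce_zero]
        have h3 : ce (-(d * u ^ 2 / (2 * b))) * ce (d * u ^ 2 / (2 * b)) = 1 := by rw [← ce_add]; simp [ce_zero]
        have h4 : ((c⁻¹ : ℝ) : ℂ) * c = 1 := by rw [← Complex.ofReal_mul, inv_mul_cancel₀ hc0]; simp
        linear_combination (FourierTransform.fourier g (u / B)) * ((((c⁻¹ : ℝ) : ℂ) * c) * (ce (-(d * u ^ 2 / (2 * b))) * ce (d * u ^ 2 / (2 * b))) * h2 + (((c⁻¹ : ℝ) : ℂ) * c) * h3 + h4)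
      · exact (continuous_const.mul (continuous_const.mul (ce_cont.comp (by fun_prop)))).aestronglyMeasurable
      · exact Eventually.of_forall fun s => by simp [ce_norm]
    exact (integrable_comp_div_iff _ hB.ne').1 h1
  filter_upwards [fourier_inv_ae g hg hG] with s hs
  have h5 : ce (-(a * s ^ 2 / (2 * b))) * g s = f s := by
    simp only [g]; rw [← mul_assoc, ← ce_add]; simp [ce_zero]
  rw [← h5, ← hs, Real.fourierInv_eq']
  have h6 := Measure.integral_comp_div (fun v => Complex.exp (↑(2 * π * (v * s)) * Complex.I) • FourierTransform.fourier g v) B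
  rw [abs_of_pos hB] at h6
  have h7 : ∀ I J : ℂ, I = B • J → J = (c * c) • I := by
    intro I J h; rw [h, hcc, smul_smul, inv_mul_cancel₀ hB.ne', one_smul]
  have h8 := h7 _ _ h6
  have h9 : ∀ v, inner ℝ v s = v * s := fun v => by simp [mul_comm]
  simp_rw [h9]
  rw [h8, ← integral_smul, ← integral_const_mul]
  congr 1; ext u
  have : Complex.exp (↑(2 * π * (u / B * s)) * Complex.I) = ce (u * s / b) := by
    unfold ce; congr 3; rw [hBdef]; field_simp
  rw [this, show -(d * u ^ 2 / (2 * b)) + u * s / b - a * s ^ 2 / (2 * b)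
      = -(d * u ^ 2 / (2 * b)) + u * s / b + -(a * s ^ 2 / (2 * b)) by ring, ce_add, ce_add]
  simp only [Complex.real_smul, smul_eq_mul]
  have h2 : ce (π / 4) * ce (-(π/4)) = 1 := by rw [← ce_add]; simp [ce_zero]
  have h3 : ce (-(d * u ^ 2 / (2 * b))) * ce (d * u ^ 2 / (2 * b)) = 1 := by rw [← ce_add]; simp [ce_zero]
  push_cast
  linear_combination (-(c:ℂ) * c * ce (u * s / b) * ce (-(a * s ^ 2 / (2 * b))) * (FourierTransform.fourier g (u / B))) * ((ce (-(d * u ^ 2 / (2 * b))) * ce (d * u ^ 2 / (2 * b))) * h2 + h3)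

/-- generic kernel -/
def Kq (μ : ℍ[ℝ]) (a b d s u : ℝ) : ℍ[ℝ] :=
  (Real.sqrt (2 * π * b))⁻¹ •
    (qexp μ (-(π / 4)) * qexp μ (a * s ^ 2 / (2 * b) - s * u / b + d * u ^ 2 / (2 * b)))

/-- generic inverse kernel -/
def KqInv (μ : ℍ[ℝ]) (a b d u s : ℝ) : ℍ[ℝ] :=
  (Real.sqrt (2 * π * b))⁻¹ •
    (qexp μ (π / 4) * qexp μ (-(d * u ^ 2 / (2 * b)) + u * s / b - a * s ^ 2 / (2 * b)))

lemma qexp_cont (μ : ℍ[ℝ]) : Continuous (qexp μ) := by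
  unfold qexp
  exact (Quaternion.continuous_coe.comp Real.continuous_cos).add
    (Real.continuous_sin.smul continuous_const)

lemma qi_re : qi.re = 0 := rfl
lemma qi_imI : qi.imI = 1 := rfl
lemma qi_imJ : qi.imJ = 0 := rfl
lemma qi_imK : qi.imK = 0 := rfl
lemma qj_re : qj.re = 0 := rfl
lemma qj_imI : qj.imI = 0 := rfl
lemma qj_imJ : qj.imJ = 1 := rfl
lemma qj_imK : qj.imK = 0 := rfl

lemma qexp_qi_norm (θ : ℝ) : ‖qexp qi θ‖ = 1 := by
  have h : ‖qexp qi θ‖ * ‖qexp qi θ‖ = 1 := by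
    rw [← Quaternion.normSq_eq_norm_mul_self, Quaternion.normSq_def']
    simp [qexp, qi_re, qi_imI, qi_imJ, qi_imK]
  nlinarith [norm_nonneg (qexp qi θ)]

lemma qexp_qj_norm (θ : ℝ) : ‖qexp qj θ‖ = 1 := by
  have h : ‖qexp qj θ‖ * ‖qexp qj θ‖ = 1 := by
    rw [← Quaternion.normSq_eq_norm_mul_self, Quaternion.normSq_def']
    simp [qexp, qj_re, qj_imI, qj_imJ, qj_imK]
  nlinarith [norm_nonneg (qexp qj θ)]

lemma Kq_cont (μ : ℍ[ℝ]) (a b d : ℝ) : Continuous (fun p : ℝ × ℝ => Kq μ a b d p.1 p.2) := by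
  unfold Kq
  exact (continuous_const.mul ((qexp_cont μ).comp (g := qexp μ) (f := fun p : ℝ × ℝ => a * p.1 ^ 2 / (2 * b) - p.1 * p.2 / b + d * p.2 ^ 2 / (2 * b)) (by fun_prop))).const_smul ((√(2 * π * b))⁻¹ : ℝ)

lemma KqInv_cont (μ : ℍ[ℝ]) (a b d : ℝ) : Continuous (fun p : ℝ × ℝ => KqInv μ a b d p.1 p.2) := by
  unfold KqInv
  exact (continuous_const.mul ((qexp_cont μ).comp (g := qexp μ) (f := fun p : ℝ × ℝ => -(d * p.1 ^ 2 / (2 * b)) + p.1 * p.2 / b - a * p.2 ^ 2 / (2 * b)) (by fun_prop))).const_smul ((√(2 * π * b))⁻¹ : ℝ)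

lemma Kq_norm (μ : ℍ[ℝ]) (hμ : ∀ θ, ‖qexp μ θ‖ = 1) (a b d s u : ℝ) :
    ‖Kq μ a b d s u‖ = (√(2 * π * b))⁻¹ := by
  unfold Kq
  rw [norm_smul, norm_mul, hμ, hμ]
  simp

lemma KqInv_norm (μ : ℍ[ℝ]) (hμ : ∀ θ, ‖qexp μ θ‖ = 1) (a b d s u : ℝ) :
    ‖KqInv μ a b d s u‖ = (√(2 * π * b))⁻¹ := by
  unfold KqInv
  rw [norm_smul, norm_mul, hμ, hμ]
  simp

lemma integrable_mul_right {α : Type*} [MeasurableSpace α] {m : Measure α} {f k : α → ℍ[ℝ]}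
    (hf : Integrable f m) (hk : AEStronglyMeasurable k m) (C : ℝ) (hC : ∀ x, ‖k x‖ ≤ C) :
    Integrable (fun x => f x * k x) m :=
  hf.mul_bdd (c := C) hk (Eventually.of_forall hC)

lemma func_Kq (μ : ℍ[ℝ]) (L : ℍ[ℝ] →L[ℝ] ℂ) (hL : ∀ q θ, L (q * qexp μ θ) = ce θ * L q)
    (a b d s u : ℝ) (q : ℍ[ℝ]) : L (q * Kq μ a b d s u) = (√(2 * π * b))⁻¹ •
      (ce (-(π / 4)) * ce (a * s ^ 2 / (2 * b) - s * u / b + d * u ^ 2 / (2 * b)) * L q) := by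
  unfold Kq
  rw [mul_smul_comm, map_smul, ← mul_assoc, hL, hL]
  congr 1; ring

lemma func_KqInv (μ : ℍ[ℝ]) (L : ℍ[ℝ] →L[ℝ] ℂ) (hL : ∀ q θ, L (q * qexp μ θ) = ce θ * L q)
    (a b d u s : ℝ) (q : ℍ[ℝ]) : L (q * KqInv μ a b d u s) = (√(2 * π * b))⁻¹ •
      (ce (π / 4) * ce (-(d * u ^ 2 / (2 * b)) + u * s / b - a * s ^ 2 / (2 * b)) * L q) := by
  unfold KqInv
  rw [mul_smul_comm, map_smul, ← mul_assoc, hL, hL]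
  congr 1; ring

lemma func_inv (μ : ℍ[ℝ]) (hμ : ∀ θ, ‖qexp μ θ‖ = 1)
    (L : ℍ[ℝ] →L[ℝ] ℂ) (hL : ∀ q θ, L (q * qexp μ θ) = ce θ * L q)
    (a b d : ℝ) (hb : 0 < b) (f : ℝ → ℍ[ℝ]) (hf : Integrable f)
    (hF : Integrable (fun u => ∫ s, f s * Kq μ a b d s u)) :
    ∀ᵐ s, L (f s) = L (∫ u, (∫ s', f s' * Kq μ a b d s' u) * KqInv μ a b d u s) := by
  have key : ∀ u, L (∫ s, f s * Kq μ a b d s u) = ∫ s, (√(2 * π * b))⁻¹ •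
      (ce (-(π / 4)) * ce (a * s ^ 2 / (2 * b) - s * u / b + d * u ^ 2 / (2 * b)) * L (f s)) := by
    intro u
    rw [← L.integral_comp_comm]
    · simp_rw [func_Kq μ L hL]
    · exact integrable_mul_right hf
        ((Kq_cont μ a b d).comp (by fun_prop : Continuous fun s : ℝ => (s, u))).aestronglyMeasurable
        _ (fun s => (Kq_norm μ hμ a b d s u).le)
  have h1 := L.integrable_comp hF
  simp_rw [key] at h1
  filter_upwards [scalar_inv a b d hb (fun s => L (f s)) (L.integrable_comp hf) h1] with s hs
  rw [hs, ← L.integral_comp_comm]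
  · simp_rw [func_KqInv μ L hL, key]
  · exact integrable_mul_right hF
      ((KqInv_cont μ a b d).comp (by fun_prop : Continuous fun u : ℝ => (u, s))).aestronglyMeasurable
      _ (fun u => (KqInv_norm μ hμ a b d u s).le)

/-- first complex coordinate for right multiplication by `i` -/
def Li1 : ℍ[ℝ] →ₗ[ℝ] ℂ where
  toFun q := ⟨q.re, q.imI⟩
  map_add' x y := by apply Complex.ext <;> simp
  map_smul' r x := by apply Complex.ext <;> simp

/-- second complex coordinate for right multiplication by `i` -/
def Li2 : ℍ[ℝ] →ₗ[ℝ] ℂ where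
  toFun q := ⟨q.imJ, -q.imK⟩
  map_add' x y := by apply Complex.ext <;> simp [add_comm]
  map_smul' r x := by apply Complex.ext <;> simp

/-- first complex coordinate for right multiplication by `j` -/
def Lj1 : ℍ[ℝ] →ₗ[ℝ] ℂ where
  toFun q := ⟨q.re, q.imJ⟩
  map_add' x y := by apply Complex.ext <;> simp
  map_smul' r x := by apply Complex.ext <;> simp

/-- second complex coordinate for right multiplication by `j` -/
def Lj2 : ℍ[ℝ] →ₗ[ℝ] ℂ where
  toFun q := ⟨q.imI, q.imK⟩
  map_add' x y := by apply Complex.ext <;> simp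
  map_smul' r x := by apply Complex.ext <;> simp

lemma ce_re (θ : ℝ) : (ce θ).re = Real.cos θ := Complex.exp_ofReal_mul_I_re θ
lemma ce_im (θ : ℝ) : (ce θ).im = Real.sin θ := Complex.exp_ofReal_mul_I_im θ

lemma inv_i (a b d : ℝ) (hb : 0 < b) (f : ℝ → ℍ[ℝ]) (hf : Integrable f)
    (hF : Integrable (fun u => ∫ s, f s * Kq qi a b d s u)) :
    ∀ᵐ s, f s = ∫ u, (∫ s', f s' * Kq qi a b d s' u) * KqInv qi a b d u s := by
  filter_upwards [func_inv qi qexp_qi_norm (LinearMap.toContinuousLinearMap Li1) (by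
      intro q θ
      apply Complex.ext <;> simp [Li1, qexp, qi_re, qi_imI, qi_imJ, qi_imK, ce_re, ce_im] <;> ring) a b d hb f hf hF,
    func_inv qi qexp_qi_norm (LinearMap.toContinuousLinearMap Li2) (by
      intro q θ
      apply Complex.ext <;> simp [Li2, qexp, qi_re, qi_imI, qi_imJ, qi_imK, ce_re, ce_im] <;> ring) a b d hb f hf hF] with s h1 h2
  simp only [LinearMap.coe_toContinuousLinearMap', Li1, Li2, LinearMap.coe_mk, AddHom.coe_mk,
    Complex.mk.injEq, neg_inj] at h1 h2
  exact Quaternion.ext _ _ h1.1 h1.2 h2.1 h2.2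

lemma inv_j (a b d : ℝ) (hb : 0 < b) (f : ℝ → ℍ[ℝ]) (hf : Integrable f)
    (hF : Integrable (fun u => ∫ s, f s * Kq qj a b d s u)) :
    ∀ᵐ s, f s = ∫ u, (∫ s', f s' * Kq qj a b d s' u) * KqInv qj a b d u s := by
  filter_upwards [func_inv qj qexp_qj_norm (LinearMap.toContinuousLinearMap Lj1) (by
      intro q θ
      apply Complex.ext <;> simp [Lj1, qexp, qj_re, qj_imI, qj_imJ, qj_imK, ce_re, ce_im] <;> ring) a b d hb f hf hF,
    func_inv qj qexp_qj_norm (LinearMap.toContinuousLinearMap Lj2) (by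
      intro q θ
      apply Complex.ext <;> simp [Lj2, qexp, qj_re, qj_imI, qj_imJ, qj_imK, ce_re, ce_im] <;> ring) a b d hb f hf hF] with s h1 h2
  simp only [LinearMap.coe_toContinuousLinearMap', Lj1, Lj2, LinearMap.coe_mk, AddHom.coe_mk,
    Complex.mk.injEq] at h1 h2
  exact Quaternion.ext _ _ h1.1 h2.1 h1.2 h2.2

lemma qint_mul_const {α : Type*} [MeasurableSpace α] {m : Measure α} (f : α → ℍ[ℝ]) (q : ℍ[ℝ]) :
    ∫ x, f x * q ∂m = (∫ x, f x ∂m) * q := by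
  by_cases hq : q = 0
  · simp [hq]
  by_cases hf : Integrable f m
  · exact integral_mul_const_of_integrable hf
  · rw [integral_undef hf, integral_undef, zero_mul]
    intro h
    apply hf
    simpa [mul_assoc, hq] using h.mul_const q⁻¹

lemma main_sm (a₁ b₁ d₁ a₂ b₂ d₂ : ℝ) (hb₁ : 0 < b₁) (hb₂ : 0 < b₂)
    (f : ℝ × ℝ → ℍ[ℝ]) (hf : Integrable f) (hm : StronglyMeasurable f)
    (hL : Integrable (fun p : ℝ × ℝ => QLCT_R a₁ b₁ d₁ a₂ b₂ d₂ f p.1 p.2)) :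
    ∀ᵐ p : ℝ × ℝ, f p = ∫ q : ℝ × ℝ,
      QLCT_R a₁ b₁ d₁ a₂ b₂ d₂ f q.1 q.2 * KqInv qj a₂ b₂ d₂ q.2 p.2 * KqInv qi a₁ b₁ d₁ q.1 p.1 := by
  set F : ℝ × ℝ → ℍ[ℝ] := fun p => QLCT_R a₁ b₁ d₁ a₂ b₂ d₂ f p.1 p.2 with hFdef
  have hFm : StronglyMeasurable F := by
    have : StronglyMeasurable (fun z : (ℝ × ℝ) × (ℝ × ℝ) =>
        f z.2 * Kq qi a₁ b₁ d₁ z.2.1 z.1.1 * Kq qj a₂ b₂ d₂ z.2.2 z.1.2) :=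
      ((hm.comp_measurable measurable_snd).mul
        ((Kq_cont qi a₁ b₁ d₁).comp (by fun_prop : Continuous fun z : (ℝ × ℝ) × (ℝ × ℝ) => (z.2.1, z.1.1))).stronglyMeasurable).mul
        ((Kq_cont qj a₂ b₂ d₂).comp (by fun_prop : Continuous fun z : (ℝ × ℝ) × (ℝ × ℝ) => (z.2.2, z.1.2))).stronglyMeasurable
    exact this.integral_prod_right'
  -- partial transforms
  let h : ℝ × ℝ → ℍ[ℝ] := fun z => ∫ s, f (s, z.2) * Kq qi a₁ b₁ d₁ s z.1
  let H : ℝ × ℝ → ℍ[ℝ] := fun z => ∫ v, F (z.1, v) * KqInv qj a₂ b₂ d₂ v z.2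
  have hhm : StronglyMeasurable h := by
    have : StronglyMeasurable (fun z : (ℝ × ℝ) × ℝ => f (z.2, z.1.2) * Kq qi a₁ b₁ d₁ z.2 z.1.1) :=
      (hm.comp_measurable (g := fun z : (ℝ × ℝ) × ℝ => (z.2, z.1.2)) (by fun_prop)).mul
        ((Kq_cont qi a₁ b₁ d₁).comp (by fun_prop : Continuous fun z : (ℝ × ℝ) × ℝ => (z.2, z.1.1))).stronglyMeasurable
    exact this.integral_prod_right'
  have hHm : StronglyMeasurable H := by
    have : StronglyMeasurable (fun z : (ℝ × ℝ) × ℝ => F (z.1.1, z.2) * KqInv qj a₂ b₂ d₂ z.2 z.1.2) :=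
      (hFm.comp_measurable (g := fun z : (ℝ × ℝ) × ℝ => (z.1.1, z.2)) (by fun_prop)).mul
        ((KqInv_cont qj a₂ b₂ d₂).comp (by fun_prop : Continuous fun z : (ℝ × ℝ) × ℝ => (z.2, z.1.2))).stronglyMeasurable
    exact this.integral_prod_right'
  have hfi : ∀ u, Integrable (fun p : ℝ × ℝ => f p * Kq qi a₁ b₁ d₁ p.1 u) := fun u =>
    integrable_mul_right hf
      ((Kq_cont qi a₁ b₁ d₁).comp (by fun_prop : Continuous fun p : ℝ × ℝ => (p.1, u))).aestronglyMeasurable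
      _ (fun p => (Kq_norm qi qexp_qi_norm a₁ b₁ d₁ p.1 u).le)
  have hhi : ∀ u, Integrable (fun t => h (u, t)) := fun u => (hfi u).integral_prod_right
  have hF1 : ∀ u v, F (u, v) = ∫ t, h (u, t) * Kq qj a₂ b₂ d₂ t v := by
    intro u v
    have hi : Integrable (fun p : ℝ × ℝ => f p * Kq qi a₁ b₁ d₁ p.1 u * Kq qj a₂ b₂ d₂ p.2 v) :=
      integrable_mul_right (hfi u)
        ((Kq_cont qj a₂ b₂ d₂).comp (by fun_prop : Continuous fun p : ℝ × ℝ => (p.2, v))).aestronglyMeasurable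
        _ (fun p => (Kq_norm qj qexp_qj_norm a₂ b₂ d₂ p.2 v).le)
    change ∫ p : ℝ × ℝ, f p * Kq qi a₁ b₁ d₁ p.1 u * Kq qj a₂ b₂ d₂ p.2 v = _
    rw [Measure.volume_eq_prod] at hi ⊢
    rw [integral_prod_symm _ hi]
    simp only [qint_mul_const, h]
  have step1 : ∀ᵐ u, ∀ᵐ t, h (u, t) = H (u, t) := by
    have := hL
    rw [Measure.volume_eq_prod] at this
    filter_upwards [this.prod_right_ae] with u hu
    have e : (fun v => F (u, v)) = fun v => ∫ t, h (u, t) * Kq qj a₂ b₂ d₂ t v :=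
      funext fun v => hF1 u v
    change Integrable (fun v => F (u, v)) at hu
    have := inv_j a₂ b₂ d₂ hb₂ (fun t => h (u, t)) (hhi u) (e ▸ hu)
    simp_rw [← hF1] at this
    exact this
  have step2 : ∀ᵐ t, ∀ᵐ u, h (u, t) = H (u, t) :=
    (Measure.ae_ae_comm (p := fun u t => h (u, t) = H (u, t))
      (hhm.measurableSet_eq_fun hHm)).1 step1
  have hFK : ∀ t, Integrable (fun q : ℝ × ℝ => F q * KqInv qj a₂ b₂ d₂ q.2 t) := fun t =>
    integrable_mul_right hL
      ((KqInv_cont qj a₂ b₂ d₂).comp (by fun_prop : Continuous fun q : ℝ × ℝ => (q.2, t))).aestronglyMeasurable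
      _ (fun q => (KqInv_norm qj qexp_qj_norm a₂ b₂ d₂ q.2 t).le)
  have hHi : ∀ t, Integrable (fun u => H (u, t)) := fun t => (hFK t).integral_prod_left
  have hI : ∀ s t, ∫ q : ℝ × ℝ, F q * KqInv qj a₂ b₂ d₂ q.2 t * KqInv qi a₁ b₁ d₁ q.1 s
      = ∫ u, H (u, t) * KqInv qi a₁ b₁ d₁ u s := by
    intro s t
    have hi : Integrable (fun q : ℝ × ℝ => F q * KqInv qj a₂ b₂ d₂ q.2 t * KqInv qi a₁ b₁ d₁ q.1 s) :=
      integrable_mul_right (hFK t)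
        ((KqInv_cont qi a₁ b₁ d₁).comp (by fun_prop : Continuous fun q : ℝ × ℝ => (q.1, s))).aestronglyMeasurable
        _ (fun q => (KqInv_norm qi qexp_qi_norm a₁ b₁ d₁ q.1 s).le)
    rw [Measure.volume_eq_prod] at hi ⊢
    rw [integral_prod _ hi]
    simp only [qint_mul_const, H]
  have step3 : ∀ᵐ t, ∀ᵐ s, f (s, t) = ∫ u, H (u, t) * KqInv qi a₁ b₁ d₁ u s := by
    have hf' := hf
    rw [Measure.volume_eq_prod] at hf'
    filter_upwards [step2, hf'.prod_left_ae] with t ht hft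
    have hh : Integrable (fun u => ∫ s, f (s, t) * Kq qi a₁ b₁ d₁ s u) :=
      (hHi t).congr (ht.mono fun u hu => hu.symm)
    filter_upwards [inv_i a₁ b₁ d₁ hb₁ (fun s => f (s, t)) hft hh] with s hs
    rw [hs]
    exact integral_congr_ae (ht.mono fun u hu => congrArg (· * KqInv qi a₁ b₁ d₁ u s) hu)
  have hGm : StronglyMeasurable (fun p : ℝ × ℝ => ∫ u, H (u, p.2) * KqInv qi a₁ b₁ d₁ u p.1) := by
    have : StronglyMeasurable (fun z : (ℝ × ℝ) × ℝ => H (z.2, z.1.2) * KqInv qi a₁ b₁ d₁ z.2 z.1.1) :=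
      (hHm.comp_measurable (g := fun z : (ℝ × ℝ) × ℝ => (z.2, z.1.2)) (by fun_prop)).mul
        ((KqInv_cont qi a₁ b₁ d₁).comp (by fun_prop : Continuous fun z : (ℝ × ℝ) × ℝ => (z.2, z.1.1))).stronglyMeasurable
    exact this.integral_prod_right'
  have hms := hm.measurableSet_eq_fun hGm
  have step4 : ∀ᵐ s, ∀ᵐ t, f (s, t) = ∫ u, H (u, t) * KqInv qi a₁ b₁ d₁ u s :=
    (Measure.ae_ae_comm (p := fun s t => f (s, t) = ∫ u, H (u, t) * KqInv qi a₁ b₁ d₁ u s) hms).2 step3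
  have step5 := (Measure.ae_prod_iff_ae_ae (μ := (volume : Measure ℝ)) (ν := (volume : Measure ℝ)) hms).2 step4
  rw [← Measure.volume_eq_prod] at step5
  filter_upwards [step5] with p hp
  rw [hp, ← hI]

/-- Inversion theorem for the right-sided QLCT of an integrable function with integrable QLCT. -/
theorem qlct_right_sided_inversion_L1
    (a₁ b₁ c₁ d₁ a₂ b₂ c₂ d₂ : ℝ)
    (hA₁ : a₁ * d₁ - b₁ * c₁ = 1) (hA₂ : a₂ * d₂ - b₂ * c₂ = 1)
    (hb₁ : 0 < b₁) (hb₂ : 0 < b₂)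
    (f : ℝ × ℝ → ℍ[ℝ]) (hf : Integrable f)
    (hL : Integrable (fun p : ℝ × ℝ => QLCT_R a₁ b₁ d₁ a₂ b₂ d₂ f p.1 p.2)) :
    ∀ᵐ p : ℝ × ℝ, f p = ∫ q : ℝ × ℝ,
      QLCT_R a₁ b₁ d₁ a₂ b₂ d₂ f q.1 q.2 * KAjInv a₂ b₂ d₂ q.2 p.2 * KAiInv a₁ b₁ d₁ q.1 p.1 := by
  have hfg : f =ᵐ[volume] hf.1.mk f := hf.1.ae_eq_mk
  have hQ : ∀ u v, QLCT_R a₁ b₁ d₁ a₂ b₂ d₂ f u v = QLCT_R a₁ b₁ d₁ a₂ b₂ d₂ (hf.1.mk f) u v := by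
    intro u v
    exact integral_congr_ae (hfg.mono fun p hp =>
      congrArg (fun x => x * KAi a₁ b₁ d₁ p.1 u * KAj a₂ b₂ d₂ p.2 v) hp)
  simp_rw [hQ] at hL ⊢
  filter_upwards [hfg, main_sm a₁ b₁ d₁ a₂ b₂ d₂ hb₁ hb₂ _ (hf.congr hfg)
    hf.1.stronglyMeasurable_mk hL] with p h1 h2
  rw [h1]
  exact h2
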